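/- arXiv:1611.08043 — 4 statements merged into one kernel-verified Lean document; each statement's English description precedes it below -/
import Mathlib

section
/- Let R = E·Z^d be a cocompact lattice in R^d (E an invertible d×d real matrix) and let k ∈ R^d. Then the averages (1/#(R ∩ B_r)) · Σ_{n ∈ R ∩ B_r} e^{2πi k·n} tend to 0 as r → ∞ if and only if k does not belong to the dual lattice R* = {k ∈ R^d : k·n ∈ Z for all n ∈ R}. (If k ∈ R*, each average equals 1.) -/
open scoped RealInnerProductSpace
open Filter MeasureTheory

/-- The cocompact lattice `R = E·ℤ^d` in `ℝ^d`. -/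
noncomputable def latticeSet {d : ℕ} (E : Matrix (Fin d) (Fin d) ℝ) :
    Set (EuclideanSpace ℝ (Fin d)) :=
  Set.range fun m : Fin d → ℤ =>
    (EuclideanSpace.equiv (Fin d) ℝ).symm (E.mulVec fun j => (m j : ℝ))

/-- The dual lattice `R* = {k : k·n ∈ ℤ for all n ∈ R}`. -/
noncomputable def dualLattice {d : ℕ} (E : Matrix (Fin d) (Fin d) ℝ) :
    Set (EuclideanSpace ℝ (Fin d)) :=
  {k | ∀ n ∈ latticeSet E, ∃ z : ℤ, ⟪k, n⟫ = (z : ℝ)}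

/-- The linear isomorphism given by the matrix `E`. -/
lemma exists_equiv {d : ℕ} (E : Matrix (Fin d) (Fin d) ℝ) (hE : IsUnit E.det) :
    ∃ T : (Fin d → ℝ) ≃L[ℝ] EuclideanSpace ℝ (Fin d),
      ∀ x, T x = (EuclideanSpace.equiv (Fin d) ℝ).symm (E.mulVec x) := by
  have hu : Invertible E := (Matrix.isUnit_iff_isUnit_det E).mpr hE |>.invertible
  exact ⟨(Matrix.toLinearEquiv' E hu).toContinuousLinearEquiv.trans
    (EuclideanSpace.equiv (Fin d) ℝ).symm, fun x => rfl⟩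

lemma mem_L_iff {d : ℕ} (x : Fin d → ℝ) :
    x ∈ (Submodule.span ℤ (Set.range (Pi.basisFun ℝ (Fin d))) : Set (Fin d → ℝ)) ↔
      ∃ m : Fin d → ℤ, x = fun j => (m j : ℝ) := by
  rw [SetLike.mem_coe, Module.Basis.mem_span_iff_repr_mem]
  simp only [Pi.basisFun_repr, Set.mem_range, algebraMap_int_eq, eq_intCast]
  constructor
  · intro h
    choose m hm using h
    exact ⟨m, funext fun j => (hm j).symm⟩
  · rintro ⟨m, rfl⟩ j
    exact ⟨m j, rfl⟩

lemma count_asymp {d : ℕ} (E : Matrix (Fin d) (Fin d) ℝ) (hE : IsUnit E.det) :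
    ∃ v : ℝ, 0 < v ∧ Tendsto (fun r : ℝ =>
      (Nat.card ↥(latticeSet E ∩ Metric.closedBall 0 r) : ℝ) / r ^ d) atTop (nhds v) := by
  obtain ⟨T, hT⟩ := exists_equiv E hE
  set s : Set (Fin d → ℝ) := T ⁻¹' Metric.closedBall 0 1 with hs
  have hconv : Convex ℝ s := (convex_closedBall 0 1).linear_preimage T.toLinearEquiv.toLinearMap
  have hbdd : Bornology.IsBounded s := by
    have : s = T.symm '' Metric.closedBall 0 1 := by
      rw [T.symm.image_eq_preimage_symm]; rfl
    rw [this]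
    exact ((isCompact_closedBall (0 : EuclideanSpace ℝ (Fin d)) 1).image
      T.symm.continuous).isBounded
  have hcl : IsClosed s := Metric.isClosed_closedBall.preimage T.continuous
  refine ⟨volume.real s, ?_, ?_⟩
  · refine ENNReal.toReal_pos ?_ hbdd.measure_lt_top.ne
    refine ne_of_gt (lt_of_lt_of_le ?_ (measure_mono
      (Set.preimage_mono (f := T) Metric.ball_subset_closedBall)))
    exact (Metric.isOpen_ball.preimage T.continuous).measure_pos _ ⟨0, by simp⟩
  · have key := tendsto_card_div_pow_atTop_volume' s hbdd hcl.measurableSet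
      (hconv.addHaar_frontier volume) (fun x y hx hxy => by
        intro z hz
        have hy : 0 < y := hx.trans_le hxy
        rw [Set.mem_smul_set_iff_inv_smul_mem₀ hx.ne'] at hz
        rw [Set.mem_smul_set_iff_inv_smul_mem₀ hy.ne']
        simp only [hs, Set.mem_preimage, map_smul, mem_closedBall_zero_iff, norm_smul,
          norm_inv, Real.norm_eq_abs, abs_of_pos hx, abs_of_pos hy] at hz ⊢
        refine le_trans ?_ hz
        gcongr)
    refine key.congr' ?_
    filter_upwards [eventually_gt_atTop 0] with x hx
    rw [Fintype.card_fin]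
    congr 2
    refine Nat.card_congr (Equiv.subtypeEquiv
      (T.toEquiv.trans (Equiv.smulRight hx.ne')) fun u => ?_)
    simp only [Set.mem_inter_iff]
    rw [and_comm, Set.mem_inv_smul_set_iff₀ hx.ne', mem_L_iff]
    refine and_congr ?_ ?_
    · have : (T.toEquiv.trans (Equiv.smulRight hx.ne')) u = T (x • u) := by simp
      rw [this]
      simp only [latticeSet, Set.mem_range, ← hT]
      constructor
      · rintro ⟨m, hm⟩; exact ⟨m, by rw [hm]⟩
      · rintro ⟨m, hm⟩; exact ⟨m, (T.injective hm).symm⟩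
    · have : (T.toEquiv.trans (Equiv.smulRight hx.ne')) u = x • T u := rfl
      rw [this]
      simp only [hs, Set.mem_preimage, mem_closedBall_zero_iff, norm_smul, Real.norm_eq_abs,
        abs_of_pos hx]
      exact (mul_le_iff_le_one_right hx).symm

lemma ball_finite {d : ℕ} (E : Matrix (Fin d) (Fin d) ℝ) (hE : IsUnit E.det) (r : ℝ) :
    (latticeSet E ∩ Metric.closedBall 0 r).Finite := by
  obtain ⟨v, hv, h⟩ := count_asymp E hE
  obtain ⟨R, hR, hrR⟩ := ((h.eventually_const_lt hv).and (eventually_ge_atTop r)).exists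
  have hne : Nat.card ↥(latticeSet E ∩ Metric.closedBall 0 R) ≠ 0 := by
    intro h0
    rw [h0] at hR
    simp at hR
  have := (Nat.card_ne_zero.mp hne).2
  exact (Set.toFinite (latticeSet E ∩ Metric.closedBall 0 R)).subset
    (Set.inter_subset_inter_right _ (Metric.closedBall_subset_closedBall hrR))

lemma ratio_tendsto {d : ℕ} (E : Matrix (Fin d) (Fin d) ℝ) (hE : IsUnit E.det) (c : ℝ) :
    Tendsto (fun r : ℝ =>
      (Nat.card ↥(latticeSet E ∩ Metric.closedBall 0 (r + c)) : ℝ) /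
      (Nat.card ↥(latticeSet E ∩ Metric.closedBall 0 r) : ℝ)) atTop (nhds 1) := by
  obtain ⟨v, hv, h⟩ := count_asymp E hE
  have h1 := h.comp (tendsto_atTop_add_const_right atTop c tendsto_id)
  have h2 : Tendsto (fun r : ℝ => ((r + c) / r) ^ d) atTop (nhds 1) := by
    have : Tendsto (fun r : ℝ => (1 + c / r) ^ d) atTop (nhds ((1 + 0) ^ d)) :=
      ((tendsto_const_nhds.div_atTop tendsto_id).const_add 1).pow d
    rw [add_zero, one_pow] at this
    refine this.congr' ?_
    filter_upwards [eventually_gt_atTop 0] with r hr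
    field_simp
  have h3 := (h1.div h hv.ne').mul h2
  rw [div_self hv.ne', one_mul] at h3
  refine h3.congr' ?_
  filter_upwards [eventually_gt_atTop 0, eventually_gt_atTop (-c)] with r hr hr2
  have : 0 < r + c := by linarith
  simp only [Function.comp, id, Pi.div_apply, div_pow]
  have e1 : r ^ d ≠ 0 := by positivity
  have e2 : (r + c) ^ d ≠ 0 := by positivity
  by_cases e3 : (Nat.card ↥(latticeSet E ∩ Metric.closedBall 0 r) : ℝ) = 0
  · rw [e3]; simp only [zero_div, div_zero, zero_mul]
  field_simp

/-- Abstract estimate for a character sum over a finite set and a larger finite set. -/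
lemma shift_bound {V : Type*} [AddCommGroup V] (A B : Finset V) (hAB : A ⊆ B) (v : V)
    (hv : ∀ a ∈ A, a + v ∈ B) (f : V → ℂ) (hf : ∀ x, ‖f x‖ ≤ 1)
    (hadd : ∀ x, f (x + v) = f x * f v) :
    ‖∑ a ∈ A, f a‖ * ‖f v - 1‖ ≤ 2 * ((B.card : ℝ) - A.card) := by
  classical
  have main : ∀ C : Finset V, C ⊆ B → C.card = A.card →
      ‖∑ b ∈ B, f b - ∑ a ∈ C, f a‖ ≤ (B.card : ℝ) - A.card := by
    intro C hC hcard
    rw [← Finset.sum_sdiff hC, add_sub_cancel_right]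
    refine (norm_sum_le_of_le _ (fun b _ => hf b)).trans ?_
    rw [Finset.sum_const, nsmul_eq_mul, mul_one, Finset.card_sdiff_of_subset hC, hcard,
      Nat.cast_sub (Finset.card_le_card hAB)]
  have h1 := main A hAB rfl
  have h2 := main (A.map (addRightEmbedding v)) (by
    intro x hx
    simp only [Finset.mem_map, addRightEmbedding_apply] at hx
    obtain ⟨a, ha, rfl⟩ := hx
    exact hv a ha) (by simp)
  rw [Finset.sum_map] at h2
  simp only [addRightEmbedding_apply, hadd, ← Finset.sum_mul] at h2
  rw [← norm_mul]
  have : (∑ a ∈ A, f a) * (f v - 1) = (∑ b ∈ B, f b - ∑ a ∈ A, f a) -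
    (∑ b ∈ B, f b - (∑ a ∈ A, f a) * f v) := by ring
  rw [this]
  refine (norm_sub_le _ _).trans ?_
  linarith

lemma lattice_add {d : ℕ} (E : Matrix (Fin d) (Fin d) ℝ) {x y : EuclideanSpace ℝ (Fin d)}
    (hx : x ∈ latticeSet E) (hy : y ∈ latticeSet E) : x + y ∈ latticeSet E := by
  obtain ⟨m, rfl⟩ := hx
  obtain ⟨n, rfl⟩ := hy
  refine ⟨m + n, ?_⟩
  simp only [← map_add, ← Matrix.mulVec_add]
  congr 2
  funext j
  simp

lemma lattice_zero {d : ℕ} (E : Matrix (Fin d) (Fin d) ℝ) : 0 ∈ latticeSet E := by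
  refine ⟨0, ?_⟩
  have : (fun j : Fin d => (((0 : Fin d → ℤ) j : ℤ) : ℝ)) = 0 := by funext j; simp
  simp only [this, Matrix.mulVec_zero, map_zero]

/-- The character `e^{2πi k·n}`. -/
noncomputable def chi {d : ℕ} (k n : EuclideanSpace ℝ (Fin d)) : ℂ :=
  Complex.exp (2 * Real.pi * Complex.I * (⟪k, n⟫ : ℂ))

lemma chi_add {d : ℕ} (k x y : EuclideanSpace ℝ (Fin d)) :
    chi k (x + y) = chi k x * chi k y := by
  simp only [chi, ← Complex.exp_add, inner_add_right, Complex.ofReal_add]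
  ring_nf

lemma chi_norm {d : ℕ} (k x : EuclideanSpace ℝ (Fin d)) : ‖chi k x‖ = 1 := by
  have : (2 * Real.pi * Complex.I * (⟪k, x⟫ : ℂ)) =
    ((2 * Real.pi * ⟪k, x⟫ : ℝ) : ℂ) * Complex.I := by push_cast; ring
  rw [chi, this, Complex.norm_exp_ofReal_mul_I]

lemma chi_eq_one_iff {d : ℕ} (k x : EuclideanSpace ℝ (Fin d)) :
    chi k x = 1 ↔ ∃ z : ℤ, ⟪k, x⟫ = (z : ℝ) := by
  rw [chi, Complex.exp_eq_one_iff]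
  refine exists_congr fun z => ?_
  have h : (2 * Real.pi * Complex.I : ℂ) ≠ 0 := Complex.two_pi_I_ne_zero
  rw [mul_comm (z : ℂ), mul_right_inj' h]
  norm_cast

lemma avg_one {d : ℕ} (E : Matrix (Fin d) (Fin d) ℝ) (hE : IsUnit E.det)
    (k : EuclideanSpace ℝ (Fin d)) (hk : k ∈ dualLattice E) (r : ℝ) (hr : 0 ≤ r) :
    ((Nat.card ↥(latticeSet E ∩ Metric.closedBall 0 r) : ℂ))⁻¹ *
      ∑' n : ↥(latticeSet E ∩ Metric.closedBall 0 r), chi k n = 1 := by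
  have : Finite ↥(latticeSet E ∩ Metric.closedBall 0 r) := (ball_finite E hE r).to_subtype
  have : Nonempty ↥(latticeSet E ∩ Metric.closedBall 0 r) :=
    ⟨⟨0, lattice_zero E, by simpa using hr⟩⟩
  have h1 : ∀ n : ↥(latticeSet E ∩ Metric.closedBall 0 r), chi k n = 1 :=
    fun n => (chi_eq_one_iff _ _).mpr (hk n n.2.1)
  simp only [h1, tsum_const, nsmul_eq_mul, mul_one]
  exact inv_mul_cancel₀ (Nat.cast_ne_zero.mpr Nat.card_pos.ne')

lemma avg_tendsto {d : ℕ} (E : Matrix (Fin d) (Fin d) ℝ) (hE : IsUnit E.det)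
    (k : EuclideanSpace ℝ (Fin d)) (hk : k ∉ dualLattice E) :
    Tendsto (fun r : ℝ => ((Nat.card ↥(latticeSet E ∩ Metric.closedBall 0 r) : ℂ))⁻¹ *
      ∑' n : ↥(latticeSet E ∩ Metric.closedBall 0 r), chi k n) atTop (nhds 0) := by
  simp only [dualLattice, Set.mem_ofPred_eq, not_forall] at hk
  obtain ⟨v, hv, hkv⟩ := hk
  rw [← chi_eq_one_iff] at hkv
  have hpos : 0 < ‖chi k v - 1‖ := norm_pos_iff.mpr (sub_ne_zero.mpr hkv)
  have hlim := (((ratio_tendsto E hE ‖v‖).sub_const 1).const_mul 2).div_const ‖chi k v - 1‖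
  rw [sub_self, mul_zero, zero_div] at hlim
  refine squeeze_zero_norm' ?_ hlim
  filter_upwards [eventually_ge_atTop 0] with r hr
  have hA := ball_finite E hE r
  have hB := ball_finite E hE (r + ‖v‖)
  have hb := shift_bound hA.toFinset hB.toFinset (by
      rw [Set.Finite.toFinset_subset_toFinset]
      exact Set.inter_subset_inter_right _ (Metric.closedBall_subset_closedBall (by simp)))
    v (by
      intro a ha
      rw [Set.Finite.mem_toFinset] at ha ⊢
      refine ⟨lattice_add E ha.1 hv, ?_⟩
      have := ha.2
      rw [mem_closedBall_zero_iff] at this ⊢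
      exact (norm_add_le _ _).trans (by linarith))
    (chi k) (fun x => (chi_norm k x).le) (fun x => chi_add k x v)
  have hsum : ∑' n : ↥(latticeSet E ∩ Metric.closedBall 0 r), chi k n =
      ∑ a ∈ hA.toFinset, chi k a := by
    rw [← Finset.tsum_subtype', hA.coe_toFinset]
  rw [← Set.ncard_eq_toFinset_card _ hA, ← Set.ncard_eq_toFinset_card _ hB,
    ← Nat.card_coe_set_eq, ← Nat.card_coe_set_eq] at hb
  have hN : (0 : ℝ) < Nat.card ↥(latticeSet E ∩ Metric.closedBall 0 r) := by
    have : Finite ↥(latticeSet E ∩ Metric.closedBall 0 r) := hA.to_subtype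
    have : Nonempty ↥(latticeSet E ∩ Metric.closedBall 0 r) :=
      ⟨⟨0, lattice_zero E, by simpa using hr⟩⟩
    exact_mod_cast Nat.card_pos
  rw [hsum, norm_mul, norm_inv, Complex.norm_natCast, le_div_iff₀ hpos, mul_assoc,
    inv_mul_le_iff₀ hN]
  refine hb.trans (le_of_eq ?_)
  field_simp

/-- Lemma 2.2: the Weyl averages of `e^{2πi k·n}` over lattice points in balls tend to `0`
iff `k ∉ R*`; and if `k ∈ R*` every average equals `1`. -/
theorem stmt0 {d : ℕ} (E : Matrix (Fin d) (Fin d) ℝ) (hE : IsUnit E.det)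
    (k : EuclideanSpace ℝ (Fin d)) :
    (Tendsto
        (fun r : ℝ =>
          ((Nat.card ↥(latticeSet E ∩ Metric.closedBall 0 r) : ℂ))⁻¹ *
            ∑' n : ↥(latticeSet E ∩ Metric.closedBall 0 r),
              Complex.exp (2 * Real.pi * Complex.I *
                (⟪k, (n : EuclideanSpace ℝ (Fin d))⟫ : ℂ)))
        atTop (nhds 0)
      ↔ k ∉ dualLattice E) ∧
    (k ∈ dualLattice E → ∀ r : ℝ, 0 ≤ r →
      ((Nat.card ↥(latticeSet E ∩ Metric.closedBall 0 r) : ℂ))⁻¹ *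
          ∑' n : ↥(latticeSet E ∩ Metric.closedBall 0 r),
            Complex.exp (2 * Real.pi * Complex.I *
              (⟪k, (n : EuclideanSpace ℝ (Fin d))⟫ : ℂ)) = 1) := by
  refine ⟨⟨fun h hk => ?_, fun hk => avg_tendsto E hE k hk⟩, fun hk r hr => avg_one E hE k hk r hr⟩
  have h1 : Tendsto (fun r : ℝ =>
      ((Nat.card ↥(latticeSet E ∩ Metric.closedBall 0 r) : ℂ))⁻¹ *
      ∑' n : ↥(latticeSet E ∩ Metric.closedBall 0 r), chi k n) atTop (nhds 1) := by
    refine tendsto_const_nhds.congr' ?_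
    filter_upwards [eventually_ge_atTop 0] with r hr
    exact (avg_one E hE k hk r hr).symm
  exact zero_ne_one (tendsto_nhds_unique h h1)
end

section
/- Let R_1, …, R_p be incommensurate cocompact lattices in R^d, Γ_j = R^d / R_j, Ω = Γ_1 × ⋯ × Γ_p with normalized Haar probability measure P, and T_a the diagonal translation. Then for every continuous function f : Ω → C, the Birkhoff ball averages (1/|B_r|) ∫_{B_r} f(T_{−a} ω) da converge as r → ∞ to ∫_Ω f dP, uniformly in ω ∈ Ω. -/
open scoped RealInnerProductSpace
open Filter MeasureTheory

/-- The lattice `R` as an additive subgroup of `ℝ^d` (the set `latticeSet E` is already closed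
under the group operations, so the closure adds nothing). -/
noncomputable def latticeGroup {d : ℕ} (E : Matrix (Fin d) (Fin d) ℝ) :
    AddSubgroup (EuclideanSpace ℝ (Fin d)) :=
  AddSubgroup.closure (latticeSet E)

/-- The quotient torus `Γ = ℝ^d / R`. -/
abbrev QuotTorus {d : ℕ} (E : Matrix (Fin d) (Fin d) ℝ) : Type :=
  EuclideanSpace ℝ (Fin d) ⧸ latticeGroup E

/-- The fundamental cell `Γ̂ = E·[−1/2, 1/2)^d`. -/
noncomputable def fundamentalCell {d : ℕ} (E : Matrix (Fin d) (Fin d) ℝ) :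
    Set (EuclideanSpace ℝ (Fin d)) :=
  Set.image (fun t : Fin d → ℝ => (EuclideanSpace.equiv (Fin d) ℝ).symm (E.mulVec t))
    {t | ∀ i, t i ∈ Set.Ico (-(1/2) : ℝ) (1/2)}

/-- The Haar measure on `ℝ^d / R` normalized to total mass `|Γ| = |det E|`, i.e., the
pushforward of the Lebesgue measure on the fundamental cell by the quotient map. -/
noncomputable def haarCell {d : ℕ} (E : Matrix (Fin d) (Fin d) ℝ) : Measure (QuotTorus E) :=
  Measure.map QuotientAddGroup.mk (volume.restrict (fundamentalCell E))

/-- The normalized Haar probability measure on the quotient torus `ℝ^d / R`. -/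
noncomputable def haarProb {d : ℕ} (E : Matrix (Fin d) (Fin d) ℝ) : Measure (QuotTorus E) :=
  (ENNReal.ofReal |E.det|)⁻¹ • haarCell E

/-- The hull `Ω = Γ_1 × ⋯ × Γ_p`. -/
abbrev Hull {d p : ℕ} (E : Fin p → Matrix (Fin d) (Fin d) ℝ) : Type :=
  (j : Fin p) → QuotTorus (E j)

/-- The normalized Haar product probability measure `P` on `Ω`. -/
noncomputable def hullProb {d p : ℕ} (E : Fin p → Matrix (Fin d) (Fin d) ℝ) :
    Measure (Hull E) :=
  Measure.pi fun j => haarProb (E j)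

/-- The diagonal translation `T_a(γ_1, …, γ_p) = (γ_1 + a, …, γ_p + a)` on `Ω`. -/
noncomputable def diagT {d p : ℕ} (E : Fin p → Matrix (Fin d) (Fin d) ℝ)
    (a : EuclideanSpace ℝ (Fin d)) : Hull E → Hull E :=
  fun ω j => ω j + QuotientAddGroup.mk a

/-- The lattices `R_1, …, R_p` are incommensurate: a tuple of dual vectors sums to zero only
if all of them vanish. -/
def Incommensurate {d p : ℕ} (E : Fin p → Matrix (Fin d) (Fin d) ℝ) : Prop :=
  ∀ k : Fin p → EuclideanSpace ℝ (Fin d), (∀ j, k j ∈ dualLattice (E j)) →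
    ((∑ j, k j) = 0 ↔ ∀ j, k j = 0)

noncomputable section HullAux

namespace HullAux

open Complex in
/-- ball averages of nontrivial characters tend to zero -/
lemma ball_avg_char {d : ℕ} (K : EuclideanSpace ℝ (Fin d)) (hK : K ≠ 0) :
    Tendsto (fun r : ℝ => ⨍ a in Metric.closedBall (0 : EuclideanSpace ℝ (Fin d)) r,
      Complex.exp (-(2 * Real.pi * Complex.I * (⟪K, a⟫ : ℝ)))) atTop (nhds 0) := by
  set F : EuclideanSpace ℝ (Fin d) → ℂ :=
    fun a => Complex.exp (-(2 * Real.pi * Complex.I * (⟪K, a⟫ : ℝ))) with hF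
  have hFc : Continuous F := by fun_prop
  have hFn : ∀ a, ‖F a‖ = 1 := by
    intro a
    have : -(2 * Real.pi * Complex.I * (⟪K, a⟫ : ℝ)) = ((-(2 * Real.pi * ⟪K, a⟫) : ℝ) : ℂ) * I := by
      push_cast; ring
    simp only [hF]
    rw [this, Complex.norm_exp_ofReal_mul_I]
  have hK2 : (‖K‖ ^ 2) ≠ 0 := by simpa using hK
  set v : EuclideanSpace ℝ (Fin d) := (1 / (2 * ‖K‖ ^ 2)) • K with hv
  have hFv : ∀ a, F (a + v) = - F a := by
    intro a
    have h1 : ⟪K, a + v⟫ = ⟪K, a⟫ + 1 / 2 := by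
      rw [inner_add_right, hv, real_inner_smul_right, real_inner_self_eq_norm_sq]
      field_simp
    simp only [hF]
    rw [h1]
    have : -(2 * (Real.pi : ℂ) * Complex.I * ((⟪K, a⟫ + 1 / 2 : ℝ) : ℂ))
      = -(2 * Real.pi * Complex.I * (⟪K, a⟫ : ℝ)) - Real.pi * I := by
      push_cast; ring
    rw [this, Complex.exp_sub, Complex.exp_pi_mul_I, div_neg, div_one]
  have hint : ∀ c r, IntegrableOn F (Metric.closedBall c r) := fun c r =>
    hFc.continuousOn.integrableOn_compact (isCompact_closedBall c r)
  have key : ∀ r : ℝ, 0 < r → ‖⨍ a in Metric.closedBall (0 : EuclideanSpace ℝ (Fin d)) r, F a‖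
      ≤ ((r + ‖v‖) / r) ^ d - 1 := by
    intro r hr
    have hV : ∀ c : EuclideanSpace ℝ (Fin d), ∀ r : ℝ, 0 ≤ r → volume.real (Metric.closedBall c r)
        = r ^ d * volume.real (Metric.ball (0 : EuclideanSpace ℝ (Fin d)) 1) := by
      intro c r hr
      rw [measureReal_def, Measure.addHaar_closedBall _ _ hr, ENNReal.toReal_mul,
        ENNReal.toReal_ofReal (by positivity), measureReal_def]
      simp
    have hVp : 0 < volume.real (Metric.ball (0 : EuclideanSpace ℝ (Fin d)) 1) := by
      rw [measureReal_def]
      exact ENNReal.toReal_pos (Metric.measure_ball_pos _ _ one_pos).ne' measure_ball_lt_top.ne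
    have hshift : ∫ a in Metric.closedBall v r, F a
        = - ∫ a in Metric.closedBall (0 : EuclideanSpace ℝ (Fin d)) r, F a := by
      have := (measurePreserving_add_right (volume : Measure (EuclideanSpace ℝ (Fin d))) v).setIntegral_preimage_emb
        (measurableEmbedding_addRight v) F (Metric.closedBall v r)
      rw [← this, ← integral_neg]
      have h2 : (fun x => x + v) ⁻¹' Metric.closedBall v r = Metric.closedBall 0 r := by
        ext x; simp [dist_eq_norm]
      rw [h2]
      simp only [hFv]
    have hd : ∀ c : EuclideanSpace ℝ (Fin d), ‖c‖ ≤ ‖v‖ →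
        ‖(∫ a in Metric.closedBall 0 (r + ‖v‖), F a) - ∫ a in Metric.closedBall c r, F a‖
        ≤ ((r + ‖v‖) ^ d - r ^ d) * volume.real (Metric.ball (0 : EuclideanSpace ℝ (Fin d)) 1) := by
      intro c hc
      have hsub : Metric.closedBall c r ⊆ Metric.closedBall 0 (r + ‖v‖) := by
        apply Metric.closedBall_subset_closedBall'
        rw [dist_zero_right]; linarith
      rw [← setIntegral_sdiff measurableSet_closedBall (hint _ _) hsub]
      refine (norm_setIntegral_le_of_norm_le_const (C := 1) ?_ ?_).trans ?_
      · exact (measure_mono Set.sdiff_subset).trans_lt measure_closedBall_lt_top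
      · intro x _; exact (hFn x).le
      · rw [measureReal_sdiff hsub measurableSet_closedBall measure_closedBall_lt_top.ne,
          hV _ _ hr.le, hV _ _ (by positivity)]
        linarith
    have h0 := hd 0 (by simp)
    have h1 := hd v le_rfl
    rw [hshift] at h1
    set I0 := ∫ a in Metric.closedBall (0 : EuclideanSpace ℝ (Fin d)) r, F a
    set U := ∫ a in Metric.closedBall (0 : EuclideanSpace ℝ (Fin d)) (r + ‖v‖), F a
    have h2 : ‖I0‖ ≤ ((r + ‖v‖) ^ d - r ^ d) * volume.real (Metric.ball (0 : EuclideanSpace ℝ (Fin d)) 1) := by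
      have e : (2 : ℂ) * I0 = (U - -I0) - (U - I0) := by ring
      have := norm_sub_le (U - -I0) (U - I0)
      rw [← e, norm_mul] at this
      simp at this h1 h0
      linarith
    rw [setAverage_eq, norm_smul, hV _ _ hr.le, norm_inv, Real.norm_of_nonneg (by positivity), div_pow]
    rw [inv_mul_le_iff₀ (by positivity)]
    refine h2.trans (le_of_eq ?_)
    field_simp
  have hlim : Tendsto (fun r : ℝ => ((r + ‖v‖) / r) ^ d - 1) atTop (nhds 0) := by
    have h1 : Tendsto (fun r : ℝ => (1 + ‖v‖ / r) ^ d - 1) atTop (nhds ((1 + 0) ^ d - 1)) :=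
      ((tendsto_const_nhds.add (tendsto_const_nhds.div_atTop tendsto_id)).pow d).sub_const 1
    simp only [add_zero, one_pow, sub_self] at h1
    refine h1.congr' ?_
    filter_upwards [eventually_gt_atTop 0] with r hr
    rw [add_div, div_self hr.ne']
  exact squeeze_zero_norm' (by filter_upwards [eventually_gt_atTop 0] with r hr using key r hr) hlim

/-- the linear parametrisation `t ↦ E t` -/
def cm {d : ℕ} (E : Matrix (Fin d) (Fin d) ℝ) (t : Fin d → ℝ) : EuclideanSpace ℝ (Fin d) :=
  (EuclideanSpace.equiv (Fin d) ℝ).symm (E.mulVec t)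

lemma cm_continuous {d : ℕ} (E : Matrix (Fin d) (Fin d) ℝ) : Continuous (cm E) := by
  unfold cm
  fun_prop

/-- inverse coordinates -/
def ci {d : ℕ} (E : Matrix (Fin d) (Fin d) ℝ) (x : EuclideanSpace ℝ (Fin d)) : Fin d → ℝ :=
  E⁻¹.mulVec (EuclideanSpace.equiv (Fin d) ℝ x)

lemma cm_ci {d : ℕ} {E : Matrix (Fin d) (Fin d) ℝ} (hE : IsUnit E.det)
    (x : EuclideanSpace ℝ (Fin d)) : cm E (ci E x) = x := by
  simp [cm, ci, Matrix.mulVec_mulVec, Matrix.mul_nonsing_inv _ hE]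

lemma ci_cm {d : ℕ} {E : Matrix (Fin d) (Fin d) ℝ} (hE : IsUnit E.det)
    (t : Fin d → ℝ) : ci E (cm E t) = t := by
  have h : (EuclideanSpace.equiv (Fin d) ℝ) (cm E t) = E.mulVec t := rfl
  rw [ci, h, Matrix.mulVec_mulVec, Matrix.nonsing_inv_mul _ hE, Matrix.one_mulVec]

lemma inner_cm {d : ℕ} (E : Matrix (Fin d) (Fin d) ℝ) (k : EuclideanSpace ℝ (Fin d))
    (t : Fin d → ℝ) : ⟪k, cm E t⟫ = ∑ i, ⟪k, cm E (Pi.single i 1)⟫ * t i := by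
  have h : cm E t = ∑ i, t i • cm E (Pi.single i 1) := by
    ext l
    simp [cm, Matrix.mulVec, dotProduct, mul_comm]
  rw [h, inner_sum]
  simp [real_inner_smul_right, mul_comm]

lemma cm_int_mem {d : ℕ} (E : Matrix (Fin d) (Fin d) ℝ) (m : Fin d → ℤ) :
    cm E (fun i => (m i : ℝ)) ∈ latticeSet E := ⟨m, rfl⟩

lemma dual_coords {d : ℕ} {E : Matrix (Fin d) (Fin d) ℝ} (hE : IsUnit E.det)
    {k : EuclideanSpace ℝ (Fin d)} (hk : k ∈ dualLattice E) :
    ∃ n : Fin d → ℤ, (∀ t, ⟪k, cm E t⟫ = ∑ i, (n i : ℝ) * t i) ∧ (n = 0 → k = 0) := by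
  have : ∀ i, ∃ z : ℤ, ⟪k, cm E (Pi.single i 1)⟫ = (z : ℝ) := by
    intro i
    apply hk
    convert cm_int_mem E (Pi.single i 1) using 2
    ext j
    by_cases h : j = i
    · subst h; simp
    · simp [h]
  choose n hn using this
  refine ⟨n, fun t => by rw [inner_cm]; simp [hn], ?_⟩
  intro h0
  have h1 : ⟪k, k⟫ = 0 := by
    conv_lhs => rw [← cm_ci hE k]
    rw [cm_ci hE k]
    nth_rewrite 2 [← cm_ci hE k]
    rw [inner_cm]; simp [hn, h0]
  simpa using h1

lemma row_dual {d : ℕ} {E : Matrix (Fin d) (Fin d) ℝ} (hE : IsUnit E.det) (i : Fin d) :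
    ∃ k ∈ dualLattice E, ∀ x, ⟪k, x⟫ = ci E x i := by
  have key : ∀ x, ⟪(EuclideanSpace.equiv (Fin d) ℝ).symm (E⁻¹ i), x⟫ = ci E x i := by
    intro x
    simp [ci, Matrix.mulVec, dotProduct, PiLp.inner_apply, mul_comm]
  refine ⟨(EuclideanSpace.equiv (Fin d) ℝ).symm (E⁻¹ i), ?_, key⟩
  rintro _ ⟨m, rfl⟩
  refine ⟨m i, ?_⟩
  rw [key]
  exact congrFun (ci_cm hE (fun j => (m j : ℝ))) i

lemma dual_closure {d : ℕ} {E : Matrix (Fin d) (Fin d) ℝ}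
    {k : EuclideanSpace ℝ (Fin d)} (hk : k ∈ dualLattice E) {x} (hx : x ∈ latticeGroup E) :
    ∃ z : ℤ, ⟪k, x⟫ = (z : ℝ) := by
  unfold latticeGroup at hx
  induction hx using AddSubgroup.closure_induction with
  | mem x hx => exact hk x hx
  | zero => exact ⟨0, by simp⟩
  | add x y _ _ hx hy =>
    obtain ⟨a, ha⟩ := hx
    obtain ⟨b, hb⟩ := hy
    exact ⟨a + b, by rw [inner_add_right, ha, hb]; push_cast; rfl⟩
  | neg x _ hx =>
    obtain ⟨a, ha⟩ := hx
    exact ⟨-a, by rw [inner_neg_right, ha]; push_cast; rfl⟩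

/-- character of one torus -/
lemma exists_char {d : ℕ} {E : Matrix (Fin d) (Fin d) ℝ}
    {k : EuclideanSpace ℝ (Fin d)} (hk : k ∈ dualLattice E) :
    ∃ χ : C(QuotTorus E, ℂ), ∀ x : EuclideanSpace ℝ (Fin d),
      χ (QuotientAddGroup.mk x) = Complex.exp (2 * Real.pi * Complex.I * (⟪k, x⟫ : ℝ)) := by
  let g : EuclideanSpace ℝ (Fin d) → ℂ :=
    fun x => Complex.exp (2 * Real.pi * Complex.I * (⟪k, x⟫ : ℝ))
  have hg : Continuous g := by fun_prop
  have hl : ∀ a b : EuclideanSpace ℝ (Fin d),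
      (QuotientAddGroup.leftRel (latticeGroup E)) a b → g a = g b := by
    intro a b hab
    rw [QuotientAddGroup.leftRel_apply] at hab
    obtain ⟨z, hz⟩ := dual_closure hk hab
    rw [inner_add_right, inner_neg_right] at hz
    have hb : ⟪k, b⟫ = ⟪k, a⟫ + z := by linarith
    simp only [g]
    rw [hb, eq_comm, Complex.exp_eq_exp_iff_exists_int]
    exact ⟨z, by push_cast; ring⟩
  refine ⟨⟨fun q => Quotient.liftOn' q g hl, ?_⟩, fun x => rfl⟩
  exact hg.quotient_liftOn' hl

lemma separates {d : ℕ} {E : Matrix (Fin d) (Fin d) ℝ} (hE : IsUnit E.det)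
    {x y : EuclideanSpace ℝ (Fin d)}
    (hxy : (QuotientAddGroup.mk x : QuotTorus E) ≠ QuotientAddGroup.mk y) :
    ∃ k ∈ dualLattice E, Complex.exp (2 * Real.pi * Complex.I * (⟪k, x⟫ : ℝ)) ≠
      Complex.exp (2 * Real.pi * Complex.I * (⟪k, y⟫ : ℝ)) := by
  by_contra! hcon
  apply hxy
  have : ∀ i, ∃ z : ℤ, ci E y i - ci E x i = z := by
    intro i
    obtain ⟨k, hk, hki⟩ := row_dual hE i
    have := hcon k hk
    rw [eq_comm, Complex.exp_eq_exp_iff_exists_int] at this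
    obtain ⟨z, hz⟩ := this
    refine ⟨z, ?_⟩
    rw [← hki, ← hki]
    have h2 : (2 * Real.pi * Complex.I : ℂ) ≠ 0 := Complex.two_pi_I_ne_zero
    have h3 : ((⟪k, y⟫ : ℝ) : ℂ) = ((⟪k, x⟫ + z : ℝ) : ℂ) := by
      apply mul_left_cancel₀ h2
      rw [hz]; push_cast; ring
    have h4 : ⟪k, y⟫ = ⟪k, x⟫ + z := by exact_mod_cast h3
    linarith
  choose m hm using this
  rw [QuotientAddGroup.eq]
  apply AddSubgroup.subset_closure
  refine ⟨m, ?_⟩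
  have h5 : (fun j => (m j : ℝ)) = ci E (-x + y) := by
    ext j
    rw [← hm]
    simp [ci, Matrix.mulVec_add, Matrix.mulVec_neg]
    ring
  simp only [h5]
  exact cm_ci hE _

lemma t2_torus {d : ℕ} {E : Matrix (Fin d) (Fin d) ℝ} (hE : IsUnit E.det) :
    T2Space (QuotTorus E) := by
  have : ∀ a b : QuotTorus E, a ≠ b → ∃ χ : C(QuotTorus E, ℂ), χ a ≠ χ b := by
    intro a b
    induction a using QuotientAddGroup.induction_on with | _ x =>
    induction b using QuotientAddGroup.induction_on with | _ y =>
    intro hab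
    obtain ⟨k, hk, hne⟩ := separates hE hab
    obtain ⟨χ, hχ⟩ := exists_char hk
    exact ⟨χ, by rw [hχ, hχ]; exact hne⟩
  refine ⟨fun a b hab => ?_⟩
  obtain ⟨χ, hχ⟩ := this a b hab
  exact separated_by_continuous χ.continuous hχ

/-- centred unit cube -/
def cube (d : ℕ) : Set (Fin d → ℝ) := Set.univ.pi fun _ => Set.Ico (-(1/2) : ℝ) (1/2)

lemma cube_eq (d : ℕ) : cube d = {t | ∀ i, t i ∈ Set.Ico (-(1/2) : ℝ) (1/2)} := by
  ext; simp [cube]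

lemma compact_torus {d : ℕ} {E : Matrix (Fin d) (Fin d) ℝ} (hE : IsUnit E.det) :
    CompactSpace (QuotTorus E) := by
  have hc : IsCompact (Set.univ.pi fun _ : Fin d => Set.Icc (0 : ℝ) 1) :=
    isCompact_univ_pi fun _ => isCompact_Icc
  have hmk : Continuous (fun t => (QuotientAddGroup.mk (cm E t) : QuotTorus E)) :=
    continuous_quotient_mk'.comp (cm_continuous E)
  refine ⟨?_⟩
  convert hc.image hmk
  symm
  rw [Set.eq_univ_iff_forall]
  intro a
  induction a using QuotientAddGroup.induction_on with | _ x =>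
  refine ⟨fun i => Int.fract (ci E x i), ?_, ?_⟩
  · intro i _
    exact ⟨Int.fract_nonneg _, (Int.fract_lt_one _).le⟩
  · rw [QuotientAddGroup.eq]
    apply AddSubgroup.subset_closure
    refine ⟨fun i => ⌊ci E x i⌋, ?_⟩
    have h5 : (fun j => ((⌊ci E x j⌋ : ℤ) : ℝ)) = ci E (-cm E (fun i => Int.fract (ci E x i)) + x) := by
      have : ∀ a b, ci E (-a + b) = - ci E a + ci E b := by
        intro a b
        simp [ci, Matrix.mulVec_add, Matrix.mulVec_neg]
      rw [this, ci_cm hE]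
      ext j
      simp only [Pi.add_apply, Pi.neg_apply]
      linarith [Int.fract_add_floor (ci E x j)]
    simp only [h5]
    exact cm_ci hE _

lemma borel_torus {d : ℕ} {E : Matrix (Fin d) (Fin d) ℝ} (hE : IsUnit E.det) :
    BorelSpace (QuotTorus E) := by
  have := t2_torus hE
  exact ⟨QuotientAddGroup.continuous_mk.map_eq_borel QuotientAddGroup.mk_surjective⟩

lemma haarProb_eq {d : ℕ} {E : Matrix (Fin d) (Fin d) ℝ} (hE : IsUnit E.det) :
    haarProb E = Measure.map (fun t => (QuotientAddGroup.mk (cm E t) : QuotTorus E))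
      (volume.restrict (cube d)) := by
  have hdet : E.det ≠ 0 := hE.ne_zero
  have hinj : Function.Injective (cm E) := fun a b h => by
    rw [← ci_cm hE a, h, ci_cm hE]
  have hemb : MeasurableEmbedding (cm E) := (cm_continuous E).measurableEmbedding hinj
  have hcell : fundamentalCell E = cm E '' cube d := by
    rw [cube_eq]; rfl
  have hvol : Measure.map (cm E) volume = (ENNReal.ofReal |E.det|)⁻¹ • volume := by
    have h1 := Real.map_matrix_volume_pi_eq_smul_volume_pi hdet
    have h2 : cm E = (MeasurableEquiv.toLp 2 (Fin d → ℝ)) ∘ (Matrix.toLin' E) := by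
      rfl
    rw [h2, ← Measure.map_map (MeasurableEquiv.measurable _) (by
      apply Continuous.measurable
      exact (Matrix.toLin' E).continuous_of_finiteDimensional), h1, Measure.map_smul]
    have h3 : Measure.map (MeasurableEquiv.toLp 2 (Fin d → ℝ)) volume = volume :=
      ((EuclideanSpace.volume_preserving_symm_measurableEquiv_toLp (Fin d)).symm).map_eq
    rw [h3]
    congr 1
    rw [abs_inv, ENNReal.ofReal_inv_of_pos (by positivity)]
  have hmk : Measurable (QuotientAddGroup.mk : _ → QuotTorus E) := by
    have := borel_torus hE
    exact (continuous_quotient_mk' : Continuous (QuotientAddGroup.mk : _ → QuotTorus E)).measurable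
  unfold haarProb haarCell
  rw [← Measure.map_smul, ← Measure.restrict_smul, ← hvol, hemb.restrict_map, hcell,
    hinj.preimage_image, Measure.map_map hmk hemb.measurable]
  rfl

lemma cube_prob (d : ℕ) : IsProbabilityMeasure ((volume : Measure (Fin d → ℝ)).restrict (cube d)) := by
  refine ⟨?_⟩
  rw [Measure.restrict_apply_univ, cube, volume_pi, Measure.pi_pi]
  norm_num

lemma haarProb_prob {d : ℕ} {E : Matrix (Fin d) (Fin d) ℝ} (hE : IsUnit E.det) :
    IsProbabilityMeasure (haarProb E) := by
  have := cube_prob d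
  have := borel_torus hE
  rw [haarProb_eq hE]
  apply Measure.isProbabilityMeasure_map
  exact (continuous_quotient_mk'.comp (cm_continuous E)).aemeasurable

lemma integral_char {d : ℕ} {E : Matrix (Fin d) (Fin d) ℝ} (hE : IsUnit E.det)
    {k : EuclideanSpace ℝ (Fin d)} (hk : k ∈ dualLattice E) (hk0 : k ≠ 0)
    (χ : C(QuotTorus E, ℂ)) (hχ : ∀ x : EuclideanSpace ℝ (Fin d),
      χ (QuotientAddGroup.mk x) = Complex.exp (2 * Real.pi * Complex.I * (⟪k, x⟫ : ℝ))) :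
    ∫ q, χ q ∂(haarProb E) = 0 := by
  have := borel_torus hE
  obtain ⟨n, hn, hn0⟩ := dual_coords hE hk
  have hmc : Continuous (fun t => (QuotientAddGroup.mk (cm E t) : QuotTorus E)) :=
    continuous_quotient_mk'.comp (cm_continuous E)
  rw [haarProb_eq hE, integral_map hmc.aemeasurable
    χ.continuous.aestronglyMeasurable]
  have h1 : ∀ t : Fin d → ℝ, χ (QuotientAddGroup.mk (cm E t))
      = ∏ i, Complex.exp (2 * Real.pi * Complex.I * n i * t i) := by
    intro t
    rw [hχ, hn, ← Complex.exp_sum]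
    congr 1
    push_cast
    rw [Finset.mul_sum]
    exact Finset.sum_congr rfl fun i _ => by ring
  simp only [h1]
  rw [cube, volume_pi, Measure.restrict_pi_pi,
    integral_fintype_prod_eq_prod (fun i (s : ℝ) => Complex.exp (2 * Real.pi * Complex.I * n i * s))]
  obtain ⟨i, hi⟩ : ∃ i, n i ≠ 0 := by
    by_contra! h
    exact hk0 (hn0 (funext h))
  apply Finset.prod_eq_zero (Finset.mem_univ i)
  rw [integral_Ico_eq_integral_Ioc, ← intervalIntegral.integral_of_le (by norm_num),
    integral_exp_mul_complex (by
      simp [hi, Real.pi_ne_zero])]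
  rw [div_eq_zero_iff]
  left
  rw [sub_eq_zero, Complex.exp_eq_exp_iff_exists_int]
  exact ⟨n i, by push_cast; ring⟩

/-- characters of the hull -/
def chars {d p : ℕ} (E : Fin p → Matrix (Fin d) (Fin d) ℝ) : Set C(Hull E, ℂ) :=
  {g | ∃ k : Fin p → EuclideanSpace ℝ (Fin d), (∀ j, k j ∈ dualLattice (E j)) ∧
    ∀ x : Fin p → EuclideanSpace ℝ (Fin d), g (fun j => QuotientAddGroup.mk (x j)) =
      Complex.exp (2 * Real.pi * Complex.I * ((∑ j, ⟪k j, x j⟫ : ℝ) : ℂ))}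

lemma exists_rep {d p : ℕ} (E : Fin p → Matrix (Fin d) (Fin d) ℝ) (ω : Hull E) :
    ∃ x : Fin p → EuclideanSpace ℝ (Fin d), ω = fun j => QuotientAddGroup.mk (x j) := by
  choose x hx using fun j => QuotientAddGroup.mk_surjective (ω j)
  exact ⟨x, funext fun j => (hx j).symm⟩

lemma zero_dual {d : ℕ} (E : Matrix (Fin d) (Fin d) ℝ) : 0 ∈ dualLattice E :=
  fun _ _ => ⟨0, by simp⟩

lemma one_chars {d p : ℕ} (E : Fin p → Matrix (Fin d) (Fin d) ℝ) : 1 ∈ chars E :=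
  ⟨fun _ => 0, fun _ => zero_dual _, fun x => by simp⟩

lemma mul_chars {d p : ℕ} (E : Fin p → Matrix (Fin d) (Fin d) ℝ) {f g} (hf : f ∈ chars E)
    (hg : g ∈ chars E) : f * g ∈ chars E := by
  obtain ⟨k, hk, hfk⟩ := hf
  obtain ⟨l, hl, hgl⟩ := hg
  refine ⟨fun j => k j + l j, fun j n hn => ?_, fun x => ?_⟩
  · obtain ⟨a, ha⟩ := hk j n hn
    obtain ⟨b, hb⟩ := hl j n hn
    exact ⟨a + b, by rw [inner_add_left, ha, hb]; push_cast; rfl⟩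
  · rw [ContinuousMap.mul_apply, hfk, hgl, ← Complex.exp_add]
    simp only [inner_add_left, Finset.sum_add_distrib]
    congr 1
    push_cast
    ring

lemma star_chars {d p : ℕ} (E : Fin p → Matrix (Fin d) (Fin d) ℝ) {f} (hf : f ∈ chars E) :
    star f ∈ chars E := by
  obtain ⟨k, hk, hfk⟩ := hf
  refine ⟨fun j => - k j, fun j n hn => ?_, fun x => ?_⟩
  · obtain ⟨a, ha⟩ := hk j n hn
    exact ⟨-a, by rw [inner_neg_left, ha]; push_cast; rfl⟩
  · rw [ContinuousMap.star_apply, hfk]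
    simp only [inner_neg_left, Finset.sum_neg_distrib]
    rw [Complex.star_def, ← Complex.exp_conj]
    congr 1
    simp
    exact Or.inl (map_ofNat _ 2)

lemma dense_chars {d p : ℕ} (E : Fin p → Matrix (Fin d) (Fin d) ℝ)
    (hE : ∀ j, IsUnit (E j).det) (f : C(Hull E, ℂ)) :
    f ∈ closure (Submodule.span ℂ (chars E) : Set C(Hull E, ℂ)) := by
  have : ∀ j, CompactSpace (QuotTorus (E j)) := fun j => compact_torus (hE j)
  let A := StarAlgebra.adjoin ℂ (chars E)
  have hA : A.SeparatesPoints := by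
    intro ω ω' hne
    obtain ⟨x, rfl⟩ := exists_rep E ω
    obtain ⟨y, rfl⟩ := exists_rep E ω'
    obtain ⟨j, hj⟩ := Function.ne_iff.1 hne
    obtain ⟨k, hk, hkne⟩ := separates (hE j) hj
    obtain ⟨χ, hχ⟩ := exists_char hk
    let g : C(Hull E, ℂ) := ⟨fun ω => χ (ω j), χ.continuous.comp (continuous_apply j)⟩
    have hg : g ∈ chars E := by
      refine ⟨Function.update (fun _ => 0) j k, fun i => ?_, fun z => ?_⟩
      · by_cases hi : i = j
        · subst hi; simpa using hk
        · simpa [hi] using zero_dual _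
      · change χ (QuotientAddGroup.mk (z j)) = _
        rw [hχ, Finset.sum_eq_single j]
        · simp
        · intro i _ hi; simp [hi]
        · simp
    refine ⟨g, ⟨g, StarAlgebra.subset_adjoin ℂ _ hg, rfl⟩, ?_⟩
    change χ (QuotientAddGroup.mk (x j)) ≠ χ (QuotientAddGroup.mk (y j))
    rw [hχ, hχ]
    exact hkne
  have htop := ContinuousMap.starSubalgebra_topologicalClosure_eq_top_of_separatesPoints A hA
  have hf : f ∈ A.topologicalClosure := by rw [htop]; trivial
  have hspan : (A : Set C(Hull E, ℂ)) ⊆ Submodule.span ℂ (chars E) := by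
    have h1 := StarAlgebra.adjoin_eq_span (R := ℂ) (chars E)
    have h2 : (Submonoid.closure (chars E ∪ star (chars E)) : Set C(Hull E, ℂ)) ⊆ chars E := by
      intro g hg
      induction hg using Submonoid.closure_induction with
      | mem x hx =>
        rcases hx with hx | hx
        · exact hx
        · simpa using star_chars E hx
      | one => exact one_chars E
      | mul x y _ _ hx hy => exact mul_chars E hx hy
    intro g hg
    have h3 : g ∈ Subalgebra.toSubmodule A.toSubalgebra := hg
    rw [h1] at h3
    exact Submodule.span_mono h2 h3
  exact closure_mono hspan hf

lemma diagT_cont {d p : ℕ} (E : Fin p → Matrix (Fin d) (Fin d) ℝ) (ω : Hull E) :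
    Continuous fun a => diagT E (-a) ω := by
  unfold diagT
  refine continuous_pi fun j => ?_
  exact continuous_const.add (QuotientAddGroup.continuous_mk.comp continuous_neg)

/-- ball averages -/
def bavg {d p : ℕ} (E : Fin p → Matrix (Fin d) (Fin d) ℝ) (f : Hull E → ℂ) (r : ℝ)
    (ω : Hull E) : ℂ :=
  ⨍ a in Metric.closedBall (0 : EuclideanSpace ℝ (Fin d)) r, f (diagT E (-a) ω)

lemma bavg_int {d p : ℕ} (E : Fin p → Matrix (Fin d) (Fin d) ℝ) (f : C(Hull E, ℂ)) (r : ℝ)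
    (ω : Hull E) : IntegrableOn (fun a => f (diagT E (-a) ω))
      (Metric.closedBall (0 : EuclideanSpace ℝ (Fin d)) r) :=
  (f.continuous.comp (diagT_cont E ω)).continuousOn.integrableOn_compact (isCompact_closedBall _ _)

lemma bavg_sub_le {d p : ℕ} (E : Fin p → Matrix (Fin d) (Fin d) ℝ) (f g : C(Hull E, ℂ)) {r : ℝ}
    (hr : 0 < r) {ε : ℝ} (h : ∀ ω, ‖f ω - g ω‖ ≤ ε) (ω : Hull E) :
    ‖bavg E f r ω - bavg E g r ω‖ ≤ ε := by
  have hpos : 0 < volume.real (Metric.closedBall (0 : EuclideanSpace ℝ (Fin d)) r) := by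
    rw [measureReal_def]
    exact ENNReal.toReal_pos (Metric.measure_closedBall_pos _ _ hr).ne' measure_closedBall_lt_top.ne
  unfold bavg
  rw [setAverage_eq, setAverage_eq, ← smul_sub, ← integral_sub (bavg_int E f r ω) (bavg_int E g r ω),
    norm_smul, norm_inv, Real.norm_of_nonneg hpos.le, inv_mul_le_iff₀ hpos, mul_comm]
  exact norm_setIntegral_le_of_norm_le_const measure_closedBall_lt_top fun a _ => h _

lemma hull_integrable {d p : ℕ} (E : Fin p → Matrix (Fin d) (Fin d) ℝ)
    (hE : ∀ j, IsUnit (E j).det) (f : C(Hull E, ℂ)) : Integrable f (hullProb E) := by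
  have : ∀ j, CompactSpace (QuotTorus (E j)) := fun j => compact_torus (hE j)
  have : ∀ j, BorelSpace (QuotTorus (E j)) := fun j => borel_torus (hE j)
  have : ∀ j, IsProbabilityMeasure (haarProb (E j)) := fun j => haarProb_prob (hE j)
  have : IsProbabilityMeasure (hullProb E) := by unfold hullProb; infer_instance
  refine Integrable.of_bound f.continuous.aestronglyMeasurable ‖f‖ ?_
  exact Eventually.of_forall fun ω => f.norm_coe_le_norm ω

lemma good_char {d p : ℕ} (E : Fin p → Matrix (Fin d) (Fin d) ℝ)
    (hE : ∀ j, IsUnit (E j).det) (hinc : Incommensurate E) (g : C(Hull E, ℂ)) (hg : g ∈ chars E) :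
    TendstoUniformly (bavg E g) (fun _ => ∫ ω, g ω ∂(hullProb E)) atTop := by
  have : ∀ j, BorelSpace (QuotTorus (E j)) := fun j => borel_torus (hE j)
  have : ∀ j, IsProbabilityMeasure (haarProb (E j)) := fun j => haarProb_prob (hE j)
  have : IsProbabilityMeasure (hullProb E) := by unfold hullProb; infer_instance
  obtain ⟨k, hk, hgk⟩ := hg
  by_cases h0 : ∀ j, k j = 0
  · have h1 : ∀ ω, g ω = 1 := by
      intro ω
      obtain ⟨x, rfl⟩ := exists_rep E ω
      rw [hgk]; simp [h0]
    rw [Metric.tendstoUniformly_iff]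
    intro ε hε
    filter_upwards [eventually_gt_atTop 0] with r hr ω
    have hb : bavg E g r ω = 1 := by
      unfold bavg
      simp only [h1]
      rw [setAverage_const (Metric.measure_closedBall_pos _ _ hr).ne' measure_closedBall_lt_top.ne]
    rw [hb]
    simpa [h1] using hε
  · have hK : (∑ j, k j) ≠ 0 := fun h => h0 ((hinc k hk).1 h)
    have hint : ∫ ω, g ω ∂(hullProb E) = 0 := by
      choose χ hχ using fun j => exists_char (hk j)
      have hprod : ∀ ω, g ω = ∏ j, χ j (ω j) := by
        intro ω
        obtain ⟨x, rfl⟩ := exists_rep E ω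
        rw [hgk]
        simp only [hχ]
        rw [← Complex.exp_sum, ← Finset.mul_sum]
        push_cast; rfl
      simp only [hprod]
      unfold hullProb
      rw [integral_fintype_prod_eq_prod (fun j (q : QuotTorus (E j)) => χ j q)]
      push Not at h0
      obtain ⟨j, hj⟩ := h0
      exact Finset.prod_eq_zero (Finset.mem_univ j) (integral_char (hE j) (hk j) hj _ (hχ j))
    have hball := ball_avg_char _ hK
    rw [hint, Metric.tendstoUniformly_iff]
    intro ε hε
    rw [Metric.tendsto_nhds] at hball
    filter_upwards [hball ε hε] with r hr ω
    obtain ⟨x, rfl⟩ := exists_rep E ω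
    set ω : Hull E := fun j => QuotientAddGroup.mk (x j)
    have h2 : ∀ a, g (diagT E (-a) ω) =
        g ω * Complex.exp (-(2 * Real.pi * Complex.I * (⟪∑ j, k j, a⟫ : ℝ))) := by
      intro a
      have h3 : diagT E (-a) ω = fun j => QuotientAddGroup.mk (x j + -a) := rfl
      rw [h3, hgk, hgk, ← Complex.exp_add]
      congr 1
      simp only [inner_add_right, inner_neg_right, Finset.sum_add_distrib, sum_inner,
        Finset.sum_neg_distrib]
      push_cast; ring
    have h4 : bavg E g r ω = g ω * ⨍ a in Metric.closedBall (0 : EuclideanSpace ℝ (Fin d)) r,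
        Complex.exp (-(2 * Real.pi * Complex.I * (⟪∑ j, k j, a⟫ : ℝ))) := by
      unfold bavg
      simp only [h2]
      rw [setAverage_eq, setAverage_eq, integral_const_mul, mul_smul_comm]
    have h5 : ‖g ω‖ = 1 := by
      rw [hgk]
      have : (2 * Real.pi * Complex.I * ((∑ j, ⟪k j, x j⟫ : ℝ) : ℂ))
        = ((2 * Real.pi * ∑ j, ⟪k j, x j⟫ : ℝ) : ℂ) * Complex.I := by push_cast; ring
      rw [this, Complex.norm_exp_ofReal_mul_I]
    rw [dist_comm, dist_zero_right, h4, norm_mul, h5, one_mul]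
    simpa using hr

lemma good_span {d p : ℕ} (E : Fin p → Matrix (Fin d) (Fin d) ℝ)
    (hE : ∀ j, IsUnit (E j).det) (hinc : Incommensurate E) (g : C(Hull E, ℂ))
    (hg : g ∈ Submodule.span ℂ (chars E)) :
    TendstoUniformly (bavg E g) (fun _ => ∫ ω, g ω ∂(hullProb E)) atTop := by
  induction hg using Submodule.span_induction with
  | mem g hg => exact good_char E hE hinc g hg
  | zero =>
    have : bavg E (0 : C(Hull E, ℂ)) = fun _ _ => 0 := by
      ext r ω; simp [bavg]
    rw [this]
    rw [Metric.tendstoUniformly_iff]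
    intro ε hε
    simp [hε]
  | add f g _ _ hf hg =>
    have h1 : bavg E (f + g : C(Hull E, ℂ)) = bavg E f + bavg E g := by
      ext r ω
      simp only [bavg, Pi.add_apply, ContinuousMap.add_apply]
      rw [setAverage_eq, setAverage_eq, setAverage_eq,
        integral_add (bavg_int E f r ω) (bavg_int E g r ω), smul_add]
    have h2 : (fun _ : Hull E => ∫ ω, (f + g) ω ∂(hullProb E)) =
        (fun _ => ∫ ω, f ω ∂(hullProb E)) + (fun _ => ∫ ω, g ω ∂(hullProb E)) := by
      ext _
      simp only [Pi.add_apply, ContinuousMap.add_apply]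
      exact integral_add (hull_integrable E hE f) (hull_integrable E hE g)
    rw [h1, h2]
    exact hf.add hg
  | smul c f _ hf =>
    have h1 : bavg E (c • f : C(Hull E, ℂ)) = fun r => (fun z => c * z) ∘ bavg E f r := by
      ext r ω
      simp only [bavg, Function.comp, ContinuousMap.smul_apply, smul_eq_mul]
      rw [setAverage_eq, setAverage_eq, integral_const_mul, mul_smul_comm]
    have h2 : (fun _ : Hull E => ∫ ω, (c • f) ω ∂(hullProb E)) =
        (fun z => c * z) ∘ (fun _ => ∫ ω, f ω ∂(hullProb E)) := by
      ext _
      simp only [Function.comp, ContinuousMap.smul_apply, smul_eq_mul]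
      rw [integral_const_mul]
    rw [h1, h2]
    exact (uniformContinuous_const_smul c).comp_tendstoUniformly hf

lemma good_all {d p : ℕ} (E : Fin p → Matrix (Fin d) (Fin d) ℝ)
    (hE : ∀ j, IsUnit (E j).det) (hinc : Incommensurate E) (f : C(Hull E, ℂ)) :
    TendstoUniformly (bavg E f) (fun _ => ∫ ω, f ω ∂(hullProb E)) atTop := by
  have : ∀ j, CompactSpace (QuotTorus (E j)) := fun j => compact_torus (hE j)
  have : ∀ j, IsProbabilityMeasure (haarProb (E j)) := fun j => haarProb_prob (hE j)
  have : IsProbabilityMeasure (hullProb E) := by unfold hullProb; infer_instance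
  rw [Metric.tendstoUniformly_iff]
  intro ε hε
  obtain ⟨g, hg, hfg⟩ := Metric.mem_closure_iff.1 (dense_chars E hE f) (ε / 3) (by positivity)
  have hle : ∀ ω, ‖f ω - g ω‖ ≤ ε / 3 := fun ω => by
    rw [← dist_eq_norm]
    exact (ContinuousMap.dist_apply_le_dist ω).trans hfg.le
  have hgood := Metric.tendstoUniformly_iff.1 (good_span E hE hinc g hg) (ε / 3) (by positivity)
  have hI : ‖∫ ω, f ω ∂(hullProb E) - ∫ ω, g ω ∂(hullProb E)‖ ≤ ε / 3 := by
    rw [← integral_sub (hull_integrable E hE f) (hull_integrable E hE g)]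
    refine (norm_integral_le_of_norm_le_const (Eventually.of_forall hle)).trans ?_
    simp
  filter_upwards [hgood, eventually_gt_atTop 0] with r hr hr0 ω
  have h1 := bavg_sub_le E f g hr0 hle ω
  have h2 := hr ω
  rw [← dist_eq_norm] at hI h1
  rw [dist_comm] at h1
  calc _ ≤ _ := dist_triangle4 _ (∫ ω, g ω ∂(hullProb E)) (bavg E g r ω) _
    _ < ε := by linarith

end HullAux

end HullAux

/-- Birkhoff ball averages of a continuous function converge uniformly to the mean for
incommensurate lattices. -/
theorem stmt7 {d p : ℕ} (E : Fin p → Matrix (Fin d) (Fin d) ℝ)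
    (hE : ∀ j, IsUnit (E j).det) (hinc : Incommensurate E)
    (f : Hull E → ℂ) (hf : Continuous f) :
    TendstoUniformly
      (fun (r : ℝ) (ω : Hull E) =>
        ⨍ a in Metric.closedBall (0 : EuclideanSpace ℝ (Fin d)) r, f (diagT E (-a) ω))
      (fun _ => ∫ ω, f ω ∂(hullProb E)) atTop := by
  exact HullAux.good_all E hE hinc ⟨f, hf⟩
end

section
/- Let R_1, …, R_p be incommensurate cocompact lattices in R^d, Γ_j = R^d / R_j, Ω = Γ_1 × ⋯ × Γ_p with normalized Haar probability measure P, and T_a the diagonal translation. Then P is ergodic for the translation action: every measurable set B ⊆ Ω satisfying T_a(B) = B for all a ∈ R^d has P(B) ∈ {0, 1}. -/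
open scoped RealInnerProductSpace
open Filter MeasureTheory

/-- normalised measure on the unit circle, as in Mathlib's multivariate Fourier file -/
noncomputable local instance locCircleMS : MeasureSpace UnitAddCircle := ⟨AddCircle.haarAddCircle⟩

local instance locCircleHaar : Measure.IsAddHaarMeasure (volume : Measure UnitAddCircle) :=
  inferInstanceAs (Measure.IsAddHaarMeasure AddCircle.haarAddCircle)

local instance locCircleProb : IsProbabilityMeasure (volume : Measure UnitAddCircle) :=
  inferInstanceAs (IsProbabilityMeasure AddCircle.haarAddCircle)

/-- The linear map `t ↦ E t` into Euclidean space. -/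
noncomputable def linE {d : ℕ} (E : Matrix (Fin d) (Fin d) ℝ) (t : Fin d → ℝ) :
    EuclideanSpace ℝ (Fin d) :=
  (EuclideanSpace.equiv (Fin d) ℝ).symm (E.mulVec t)

lemma linE_continuous {d : ℕ} (E : Matrix (Fin d) (Fin d) ℝ) : Continuous (linE E) := by
  unfold linE
  refine (EuclideanSpace.equiv (Fin d) ℝ).symm.continuous.comp ?_
  exact Continuous.matrix_mulVec continuous_const continuous_id

lemma linE_add {d : ℕ} (E : Matrix (Fin d) (Fin d) ℝ) (s t : Fin d → ℝ) :
    linE E (s + t) = linE E s + linE E t := by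
  unfold linE
  rw [Matrix.mulVec_add, map_add]

lemma linE_injective {d : ℕ} (E : Matrix (Fin d) (Fin d) ℝ) (hE : IsUnit E.det) :
    Function.Injective (linE E) := by
  unfold linE
  refine (EuclideanSpace.equiv (Fin d) ℝ).symm.injective.comp ?_
  exact Matrix.mulVec_injective_iff_isUnit.mpr ((Matrix.isUnit_iff_isUnit_det E).mpr hE)

lemma linE_map_volume {d : ℕ} (E : Matrix (Fin d) (Fin d) ℝ) (hE : IsUnit E.det) :
    Measure.map (linE E) volume = (ENNReal.ofReal |E.det|)⁻¹ • volume := by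
  have h0 : E.det ≠ 0 := hE.ne_zero
  have h1 := Real.map_matrix_volume_pi_eq_smul_volume_pi h0
  have h2 : linE E = (WithLp.toLp 2) ∘ (Matrix.toLin' E) := by
    funext t; rfl
  rw [h2, ← Measure.map_map (PiLp.volume_preserving_toLp (Fin d)).measurable
    (LinearMap.continuous_of_finiteDimensional _).measurable, h1, Measure.map_smul,
    (PiLp.volume_preserving_toLp (Fin d)).map_eq, abs_inv,
    ENNReal.ofReal_inv_of_pos (abs_pos.mpr h0)]

/-- representative -/
noncomputable def rep {d : ℕ} (t : UnitAddTorus (Fin d)) : Fin d → ℝ :=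
  (UnitAddTorus.measurableEquivPiIoc (fun _ => (-(1/2) : ℝ)) t).1

lemma rep_coe {d : ℕ} (t : UnitAddTorus (Fin d)) (i : Fin d) :
    ((rep t i : ℝ) : UnitAddCircle) = t i := by
  have := (UnitAddTorus.measurableEquivPiIoc (fun _ => (-(1/2) : ℝ))).symm_apply_apply t
  exact congrFun this i

lemma rep_mp {d : ℕ} : MeasurePreserving (rep (d := d)) volume
    (volume.restrict {t | ∀ i, t i ∈ Set.Ico (-(1/2) : ℝ) (1/2)}) := by
  have h1 := UnitAddTorus.measurePreserving_equivPiIoc (d := Fin d) (fun _ => (-(1/2) : ℝ))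
  have hm : MeasurableSet {x : Fin d → ℝ | ∀ i, x i ∈ Set.Ioc (-(1/2) : ℝ) (-(1/2) + 1)} :=
    MeasurableSet.univ_pi' (fun i => measurableSet_Ioc)
  have h2 : MeasurePreserving
      (Subtype.val : {x : Fin d → ℝ // ∀ i, x i ∈ Set.Ioc (-(1/2) : ℝ) (-(1/2) + 1)} → _)
      (Measure.comap Subtype.val volume) 
      (volume.restrict {x : Fin d → ℝ | ∀ i, x i ∈ Set.Ioc (-(1/2) : ℝ) (-(1/2) + 1)}) :=
    ⟨measurable_subtype_coe, map_comap_subtype_coe hm volume⟩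
  have h3 : (volume.restrict {t : Fin d → ℝ | ∀ i, t i ∈ Set.Ico (-(1/2) : ℝ) (1/2)}) =
      volume.restrict {x : Fin d → ℝ | ∀ i, x i ∈ Set.Ioc (-(1/2) : ℝ) (-(1/2) + 1)} := by
    apply Measure.restrict_congr_set
    have e1 : {t : Fin d → ℝ | ∀ i, t i ∈ Set.Ico (-(1/2) : ℝ) (1/2)} =
      Set.pi Set.univ (fun i => Set.Ico (-(1/2) : ℝ) (1/2)) := by ext; simp
    have e2 : {x : Fin d → ℝ | ∀ i, x i ∈ Set.Ioc (-(1/2) : ℝ) (-(1/2) + 1)} =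
      Set.pi Set.univ (fun i => Set.Ioc (-(1/2) : ℝ) (1/2)) := by ext; norm_num
    rw [e1, e2]
    exact (Measure.univ_pi_Ico_ae_eq_Icc (μ := fun _ : Fin d => (volume : Measure ℝ))
      (f := fun _ => (-(1/2) : ℝ)) (g := fun _ => (1/2:ℝ))).trans
      (Measure.univ_pi_Ioc_ae_eq_Icc (μ := fun _ : Fin d => (volume : Measure ℝ))
      (f := fun _ => (-(1/2) : ℝ)) (g := fun _ => (1/2:ℝ))).symm
  rw [h3]
  exact h2.comp h1

/-- parametrization of the torus -/
noncomputable def psi {d : ℕ} (E : Matrix (Fin d) (Fin d) ℝ) (t : UnitAddTorus (Fin d)) :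
    QuotTorus E :=
  QuotientAddGroup.mk (linE E (rep t))

lemma psi_mp {d : ℕ} (E : Matrix (Fin d) (Fin d) ℝ) (hE : IsUnit E.det) :
    MeasurePreserving (psi E) volume (haarProb E) := by
  have hemb : MeasurableEmbedding (linE E) :=
    (linE_continuous E).measurableEmbedding (linE_injective E hE)
  have hmk : Measurable (QuotientAddGroup.mk : _ → QuotTorus E) := measurable_quotient_mk''
  have h2 : Measure.map (linE E)
      (volume.restrict {t | ∀ i, t i ∈ Set.Ico (-(1/2) : ℝ) (1/2)}) =
      (ENNReal.ofReal |E.det|)⁻¹ • volume.restrict (fundamentalCell E) := by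
    have := hemb.restrict_map volume (fundamentalCell E)
    rw [linE_map_volume E hE] at this
    rw [← Measure.restrict_smul, this]
    congr 2
    exact (Set.preimage_image_eq _ (linE_injective E hE)).symm
  refine ⟨hmk.comp (hemb.measurable.comp rep_mp.measurable), ?_⟩
  have h3 : psi E = QuotientAddGroup.mk ∘ (linE E) ∘ rep := rfl
  rw [h3, ← Measure.map_map hmk (hemb.measurable.comp rep_mp.measurable),
    ← Measure.map_map hemb.measurable rep_mp.measurable, rep_mp.map_eq, h2, Measure.map_smul]
  rfl

lemma psi_add {d : ℕ} (E : Matrix (Fin d) (Fin d) ℝ) (t : UnitAddTorus (Fin d))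
    (x : Fin d → ℝ) :
    psi E (t + fun i => ((x i : ℝ) : UnitAddCircle)) =
      psi E t + QuotientAddGroup.mk (linE E x) := by
  unfold psi
  rw [← QuotientAddGroup.mk_add, ← linE_add]
  symm
  rw [QuotientAddGroup.eq]
  apply AddSubgroup.subset_closure
  have : ∀ i, ∃ z : ℤ, rep (t + fun i => ((x i : ℝ) : UnitAddCircle)) i = rep t i + x i + z := by
    intro i
    have h : ((rep (t + fun i => ((x i : ℝ) : UnitAddCircle)) i : ℝ) : UnitAddCircle) =
        ((rep t i + x i : ℝ) : UnitAddCircle) := by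
      rw [rep_coe, AddCircle.coe_add, rep_coe]; rfl
    rw [← sub_eq_zero, ← AddCircle.coe_sub, AddCircle.coe_eq_zero_iff] at h
    obtain ⟨z, hz⟩ := h
    refine ⟨z, ?_⟩
    rw [zsmul_eq_mul, mul_one] at hz
    linarith
  choose z hz using this
  refine ⟨z, ?_⟩
  change linE E (fun j => (z j : ℝ)) = _
  rw [eq_neg_add_iff_add_eq, ← linE_add]
  congr 1
  funext i
  rw [hz]; rfl

/-- parametrization of the hull -/
noncomputable def Psi {d p : ℕ} (E : Fin p → Matrix (Fin d) (Fin d) ℝ)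
    (t : UnitAddTorus (Fin p × Fin d)) : Hull E :=
  fun j => psi (E j) (fun i => t (j, i))

lemma Psi_mp {d p : ℕ} (E : Fin p → Matrix (Fin d) (Fin d) ℝ) (hE : ∀ j, IsUnit (E j).det) :
    MeasurePreserving (Psi E) volume (hullProb E) := by
  have : ∀ j, IsProbabilityMeasure (haarProb (E j)) := fun j => by
    rw [← (psi_mp (E j) (hE j)).map_eq]
    exact Measure.isProbabilityMeasure_map (psi_mp (E j) (hE j)).aemeasurable
  have h1 := measurePreserving_pi (fun _ : Fin p => (volume : Measure (UnitAddTorus (Fin d))))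
    (fun j => haarProb (E j)) (fun j => psi_mp (E j) (hE j))
  have h2 : MeasurePreserving (MeasurableEquiv.curry (Fin p) (Fin d) UnitAddCircle) volume
      (Measure.pi (fun _ : Fin p => (volume : Measure (UnitAddTorus (Fin d))))) := by
    refine ⟨MeasurableEquiv.measurable _, ?_⟩
    have := Measure.infinitePi_map_curry
      (fun (_ : Fin p) (_ : Fin d) => (volume : Measure UnitAddCircle))
    simp only [Measure.infinitePi_eq_pi] at this
    exact this
  exact h1.comp h2

lemma fourier_transl {ι : Type*} [Fintype ι] (n : ι → ℤ) (s t : UnitAddTorus ι) :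
    UnitAddTorus.mFourier n (s + t) = UnitAddTorus.mFourier n s * UnitAddTorus.mFourier n t := by
  simp [UnitAddTorus.mFourier, fourier_apply, smul_add, AddCircle.toCircle_add,
    Finset.prod_mul_distrib]

lemma fourier_real {ι : Type*} [Fintype ι] (n : ι → ℤ) (x : ι → ℝ)
    (h : UnitAddTorus.mFourier n (fun i => ((x i : ℝ) : UnitAddCircle)) = 1) :
    ∃ z : ℤ, ∑ i, (n i : ℝ) * x i = z := by
  simp only [UnitAddTorus.mFourier, ContinuousMap.coe_mk, fourier_coe_apply] at h
  rw [← Complex.exp_sum, Complex.exp_eq_one_iff] at h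
  obtain ⟨z, hz⟩ := h
  refine ⟨z, ?_⟩
  have h2 : (2 * Real.pi * Complex.I : ℂ) ≠ 0 := by simp [Real.pi_ne_zero]
  have : (∑ i, (n i : ℂ) * x i) * (2 * Real.pi * Complex.I) = z * (2 * Real.pi * Complex.I) := by
    rw [← hz, Finset.sum_mul]
    refine Finset.sum_congr rfl fun i _ => ?_
    simp; ring
  have := mul_right_cancel₀ h2 this
  exact_mod_cast this

lemma zero_one_of_coeff {ι : Type*} [Fintype ι] (B : Set (UnitAddTorus ι)) (hB : MeasurableSet B)
    (h : ∀ n : ι → ℤ, n ≠ 0 → 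
      UnitAddTorus.mFourierCoeff (B.indicator (fun _ => (1 : ℂ))) n = 0) :
    volume B = 0 ∨ volume B = 1 := by
  let f : Lp ℂ 2 (volume : Measure (UnitAddTorus ι)) :=
    indicatorConstLp 2 hB (measure_ne_top _ _) (1 : ℂ)
  have hf : f =ᵐ[volume] B.indicator (fun _ => (1 : ℂ)) := indicatorConstLp_coeFn
  have hc : ∀ n, UnitAddTorus.mFourierCoeff f n =
      UnitAddTorus.mFourierCoeff (B.indicator (fun _ => (1 : ℂ))) n := fun n => by
    apply integral_congr_ae
    filter_upwards [hf] with x hx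
    rw [hx]
  have hs := UnitAddTorus.hasSum_sq_mFourierCoeff f
  have h0 : ∀ n, n ≠ 0 → ‖UnitAddTorus.mFourierCoeff f n‖ ^ 2 = 0 := fun n hn => by
    rw [hc, h n hn]; simp
  have hs' := hasSum_single (f := fun n => ‖UnitAddTorus.mFourierCoeff f n‖ ^ 2) 0 h0
  have heq := hs.unique hs'
  have hI : ∫ t, ‖f t‖ ^ 2 = volume.real B := by
    rw [← integral_indicator_one hB]
    apply integral_congr_ae
    filter_upwards [hf] with x hx
    rw [hx]
    by_cases hx : x ∈ B <;> simp [hx]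
  have hC : UnitAddTorus.mFourierCoeff f 0 = (volume.real B : ℂ) := by
    rw [hc]
    unfold UnitAddTorus.mFourierCoeff
    rw [neg_zero, UnitAddTorus.mFourier_zero]
    simp only [ContinuousMap.one_apply, one_smul]
    rw [integral_indicator_const _ hB]
    simp
  rw [hI] at heq
  simp only [hC, Complex.norm_real, Real.norm_eq_abs, sq_abs] at heq
  have : volume.real B = 0 ∨ volume.real B = 1 := by
    have : volume.real B * (volume.real B - 1) = 0 := by linarith
    rcases mul_eq_zero.mp this with h | h
    · exact Or.inl h
    · exact Or.inr (by linarith)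
  rcases this with h | h
  · left; exact (measureReal_eq_zero_iff).mp h
  · right
    rw [Measure.real, ENNReal.toReal_eq_one_iff] at h
    exact h

/-- Ergodicity of the Haar measure under the diagonal translation action for incommensurate
lattices: every invariant measurable set is null or conull. -/
theorem stmt8 {d p : ℕ} (E : Fin p → Matrix (Fin d) (Fin d) ℝ)
    (hE : ∀ j, IsUnit (E j).det) (hinc : Incommensurate E)
    (B : Set (Hull E)) (hB : MeasurableSet B)
    (hBinv : ∀ a : EuclideanSpace ℝ (Fin d), diagT E a '' B = B) :
    hullProb E B = 0 ∨ hullProb E B = 1 := by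
  have hmp := Psi_mp E hE
  rw [← hmp.measure_preimage hB.nullMeasurableSet]
  refine zero_one_of_coeff _ (hmp.measurable hB) fun n hn => ?_
  by_contra hc
  apply hn
  -- invariance
  have hinv : ∀ (x : Fin p × Fin d → ℝ) (a : EuclideanSpace ℝ (Fin d)),
      (∀ j, linE (E j) (fun i => x (j, i)) = a) →
      UnitAddTorus.mFourier (-n) (fun i => ((x i : ℝ) : UnitAddCircle)) = 1 := by
    intro x a hx
    set X : UnitAddTorus (Fin p × Fin d) := fun i => ((x i : ℝ) : UnitAddCircle) with hX
    have hP : ∀ t, Psi E (t + X) = diagT E a (Psi E t) := by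
      intro t
      funext j
      have := psi_add (E j) (fun i => t (j, i)) (fun i => x (j, i))
      rw [hx j] at this
      exact this
    have hinj : Function.Injective (diagT E a) := by
      intro u v huv
      funext j
      exact add_right_cancel (congrFun huv j)
    have hmem : ∀ t, Psi E (t + X) ∈ B ↔ Psi E t ∈ B := by
      intro t
      rw [hP]
      conv_lhs => rw [← hBinv a]
      exact hinj.mem_set_image
    set f : UnitAddTorus (Fin p × Fin d) → ℂ :=
      (Psi E ⁻¹' B).indicator (fun _ => (1 : ℂ)) with hf
    have hfi : ∀ t, f (t + X) = f t := by
      intro t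
      by_cases h : Psi E t ∈ B
      · have h' := (hmem t).mpr h
        simp [hf, Set.indicator, h, h']
      · have h' : Psi E (t + X) ∉ B := fun h2 => h ((hmem t).mp h2)
        simp [hf, Set.indicator, h, h']
    have key : UnitAddTorus.mFourierCoeff f n =
        UnitAddTorus.mFourier (-n) X * UnitAddTorus.mFourierCoeff f n := by
      unfold UnitAddTorus.mFourierCoeff
      conv_lhs => rw [← integral_add_right_eq_self _ X]
      rw [← integral_const_mul]
      congr 1
      funext t
      rw [hfi, fourier_transl]
      simp only [smul_eq_mul]
      ring
    have : (UnitAddTorus.mFourier (-n) X - 1) * UnitAddTorus.mFourierCoeff f n = 0 := by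
      rw [sub_mul, ← key]; ring
    rcases mul_eq_zero.mp this with h | h
    · exact sub_eq_zero.mp h
    · exact absurd h hc
  -- dual vectors
  let v : Fin p → Fin d → ℝ := fun j => Matrix.vecMul (fun i => (n (j, i) : ℝ)) (E j)⁻¹
  let k : Fin p → EuclideanSpace ℝ (Fin d) := fun j => WithLp.toLp 2 (v j)
  have hin : ∀ j (b : EuclideanSpace ℝ (Fin d)), ⟪k j, b⟫ =
      dotProduct (fun i => (n (j, i) : ℝ)) ((E j)⁻¹.mulVec b.ofLp) := by
    intro j b
    rw [Matrix.dotProduct_mulVec, EuclideanSpace.inner_eq_star_dotProduct, dotProduct_comm]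
    simp [k, v]
  have hinE : ∀ j (t : Fin d → ℝ), ⟪k j, linE (E j) t⟫ = dotProduct (fun i => (n (j, i) : ℝ)) t := by
    intro j t
    rw [hin]
    have : (linE (E j) t).ofLp = (E j).mulVec t := rfl
    rw [this, Matrix.mulVec_mulVec, Matrix.nonsing_inv_mul _ (hE j), Matrix.one_mulVec]
  have hdual : ∀ j, k j ∈ dualLattice (E j) := by
    rintro j _ ⟨m, rfl⟩
    refine ⟨∑ i, n (j, i) * m i, ?_⟩
    refine (hinE j _).trans ?_
    simp [dotProduct]
  have hint : ∀ a : EuclideanSpace ℝ (Fin d), ∃ z : ℤ, ⟪∑ j, k j, a⟫ = (z : ℝ) := by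
    intro a
    let x : Fin p × Fin d → ℝ := fun q => (E q.1)⁻¹.mulVec a.ofLp q.2
    have hx : ∀ j, linE (E j) (fun i => x (j, i)) = a := by
      intro j
      change (WithLp.toLp 2 ((E j).mulVec ((E j)⁻¹.mulVec a.ofLp)) : EuclideanSpace ℝ (Fin d)) = a
      rw [Matrix.mulVec_mulVec, Matrix.mul_nonsing_inv _ (hE j), Matrix.one_mulVec]
    obtain ⟨z, hz⟩ := fourier_real (-n) x (hinv x a hx)
    refine ⟨-z, ?_⟩
    rw [sum_inner]
    simp only [hin]
    push_cast
    rw [← hz, Fintype.sum_prod_type]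
    simp [dotProduct, x]
  have hK : ∑ j, k j = 0 := by
    by_contra hne
    obtain ⟨z, hz⟩ := hint ((2 * ‖∑ j, k j‖ ^ 2)⁻¹ • ∑ j, k j)
    rw [inner_smul_right, real_inner_self_eq_norm_sq] at hz
    have hpos : ‖∑ j, k j‖ ≠ 0 := norm_ne_zero_iff.mpr hne
    field_simp at hz
    have h3 : (1 : ℤ) = 2 * z := by exact_mod_cast hz
    omega
  have hk0 := (hinc k hdual).mp hK
  funext ⟨j, i⟩
  have h := hinE j (Pi.single i 1)
  rw [hk0 j, inner_zero_left] at h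
  simp at h
  simpa using h.symm
end

section
/- Let R_1, …, R_p be incommensurate cocompact lattices in R^d, and let (k_2, …, k_p) ∈ R_2* × ⋯ × R_p* with not all k_j equal to 0. Then the lattice Weyl sums over R_1 satisfy (1/#(R_1 ∩ B_r)) · Σ_{n ∈ R_1 ∩ B_r} e^{−2πi (k_2 + ⋯ + k_p)·n} → 0 as r → ∞. -/
open scoped RealInnerProductSpace
open Filter MeasureTheory

open Module Topology in
theorem aux_count {d : ℕ} [NeZero d] (L : Submodule ℤ (EuclideanSpace ℝ (Fin d)))
    [DiscreteTopology L] [IsZLattice ℝ L] :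
    ∃ C : ℝ, 0 < C ∧ Tendsto (fun r : ℝ =>
      (Nat.card ↥((L : Set (EuclideanSpace ℝ (Fin d))) ∩ Metric.closedBall 0 r) : ℝ) / r ^ d)
      atTop (𝓝 C) := by
  have hd : d ≠ 0 := NeZero.ne d
  have hset : ∀ r : ℝ, 0 ≤ r →
      {x ∈ (Set.univ : Set (EuclideanSpace ℝ (Fin d))) | ‖x‖ ^ d ≤ r ^ d} =
        Metric.closedBall 0 r := by
    intro r hr
    ext x
    simp [pow_le_pow_iff_left₀ (norm_nonneg x) hr hd]
  have h1 : {x ∈ (Set.univ : Set (EuclideanSpace ℝ (Fin d))) | ‖x‖ ^ d ≤ 1} =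
        Metric.closedBall 0 1 := by
    have := hset 1 zero_le_one
    rwa [one_pow] at this
  have key := ZLattice.covolume.tendsto_card_le_div' L (X := Set.univ) (F := fun x => ‖x‖ ^ d)
    (by simp)
    (by
      intro x r hr
      rw [norm_smul, mul_pow, finrank_euclideanSpace_fin, Real.norm_of_nonneg hr])
    (by rw [h1]; exact Metric.isBounded_closedBall)
    (by rw [h1]; exact measurableSet_closedBall)
    (by
      rw [h1, frontier_closedBall _ one_ne_zero]
      exact Measure.addHaar_sphere _ _ _)
  refine ⟨_, ?_, (key.comp (Filter.tendsto_pow_atTop hd)).congr' ?_⟩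
  · apply div_pos
    · rw [h1]
      exact ENNReal.toReal_pos (Metric.measure_closedBall_pos _ _ one_pos).ne'
        measure_closedBall_lt_top.ne
    · exact ZLattice.covolume_pos L volume
  · filter_upwards [eventually_ge_atTop 0] with r hr
    simp only [Function.comp]
    rw [hset r hr, Set.inter_comm]

open Topology in
theorem aux_ratio {d : ℕ} (N : ℝ → ℝ) (C : ℝ) (hC : 0 < C)
    (h : Tendsto (fun r : ℝ => N r / r ^ d) atTop (𝓝 C)) (c : ℝ) :
    Tendsto (fun r => (N (r + c) - N r) / N r) atTop (𝓝 0) := by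
  have h2 : Tendsto (fun r : ℝ => N (r + c) / (r + c) ^ d) atTop (𝓝 C) :=
    h.comp (tendsto_atTop_add_const_right _ c tendsto_id)
  have h3 : Tendsto (fun r : ℝ => ((r + c) / r) ^ d) atTop (𝓝 (1 ^ d)) := by
    apply Tendsto.pow
    have : Tendsto (fun r : ℝ => 1 + c * r⁻¹) atTop (𝓝 (1 + c * 0)) :=
      tendsto_const_nhds.add (tendsto_const_nhds.mul tendsto_inv_atTop_zero)
    rw [mul_zero, add_zero] at this
    refine this.congr' ?_
    filter_upwards [eventually_gt_atTop 0] with r hr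
    field_simp
  have h4 := (((h2.mul h3).div h hC.ne').sub_const 1)
  have e : C * 1 ^ d / C - 1 = 0 := by simp [hC.ne']
  rw [e] at h4
  refine h4.congr' ?_
  filter_upwards [eventually_gt_atTop 0, eventually_gt_atTop (-c),
    h.eventually (lt_mem_nhds hC)] with r hr hrc hN
  have hN' : N r ≠ 0 := by
    rintro h0
    simp [h0] at hN
  have : r + c ≠ 0 := by linarith
  have := pow_ne_zero d this
  have := pow_ne_zero d hr.ne'
  simp only [Pi.div_apply, div_pow]
  field_simp

theorem aux_sum {V : Type*} [AddCommGroup V] (A B : Finset V) (n0 : V) (f : V → ℂ) (z : ℂ)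
    (hf : ∀ n, ‖f n‖ ≤ 1) (hz : ∀ n, f (n + n0) = z * f n) (hAB : A ⊆ B)
    (hAB' : ∀ a ∈ A, a + n0 ∈ B) :
    ‖(1 - z) * ∑ n ∈ A, f n‖ ≤ 2 * ((B.card : ℝ) - A.card) := by
  classical
  set A' := A.map (addRightEmbedding n0) with hA'
  have hA'B : A' ⊆ B := by
    intro x hx
    rw [hA', Finset.mem_map] at hx
    obtain ⟨a, ha, rfl⟩ := hx
    exact hAB' a ha
  have hs : ∑ n ∈ A', f n = z * ∑ n ∈ A, f n := by
    rw [hA', Finset.sum_map, Finset.mul_sum]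
    exact Finset.sum_congr rfl fun n _ => hz n
  have h1 := Finset.sum_sdiff hAB (f := f)
  have h2 := Finset.sum_sdiff hA'B (f := f)
  have b : ∀ S : Finset V, ‖∑ n ∈ S, f n‖ ≤ S.card := fun S => by
    simpa using norm_sum_le_of_le S (fun n _ => hf n)
  have e : (1 - z) * ∑ n ∈ A, f n = ∑ n ∈ B \ A', f n - ∑ n ∈ B \ A, f n := by
    rw [sub_mul, one_mul, ← hs]
    linear_combination h1 - h2
  have c1 : ((B \ A).card : ℝ) = B.card - A.card := Finset.cast_card_sdiff hAB
  have c2 : ((B \ A').card : ℝ) = B.card - A.card := by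
    rw [Finset.cast_card_sdiff hA'B, hA', Finset.card_map]
  rw [e]
  have := norm_sub_le (∑ n ∈ B \ A', f n) (∑ n ∈ B \ A, f n)
  have := b (B \ A')
  have := b (B \ A)
  linarith

theorem aux_lattice {d : ℕ} (E : Matrix (Fin d) (Fin d) ℝ) (hE : IsUnit E.det) :
    ∃ b : Module.Basis (Fin d) ℝ (EuclideanSpace ℝ (Fin d)),
      latticeSet E = (Submodule.span ℤ (Set.range b) : Set (EuclideanSpace ℝ (Fin d))) := by
  have hE' : IsUnit E := (Matrix.isUnit_iff_isUnit_det E).2 hE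
  let e := (Matrix.toLinearEquiv' E ((Matrix.isUnit_iff_isUnit_det E).2 hE).invertible)
  refine ⟨((Pi.basisFun ℝ (Fin d)).map e).map (EuclideanSpace.equiv (Fin d) ℝ).symm.toLinearEquiv, ?_⟩
  ext x
  simp only [latticeSet, Set.mem_range, SetLike.mem_coe, Submodule.mem_span_range_iff_exists_fun]
  refine exists_congr fun m => ?_
  have : (EuclideanSpace.equiv (Fin d) ℝ).symm (E.mulVec fun j => (m j : ℝ)) =
    ∑ i, m i • (((Pi.basisFun ℝ (Fin d)).map e).map
      (EuclideanSpace.equiv (Fin d) ℝ).symm.toLinearEquiv) i := by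
    have h2 : (fun j => (m j : ℝ)) = ∑ i, m i • (Pi.single i 1 : Fin d → ℝ) := by
      ext j
      simp [Finset.sum_apply, Pi.single_apply]
    have h3 : ∀ v, E.mulVec v = e v := fun v => rfl
    rw [h3, h2, map_sum, map_sum]
    refine Finset.sum_congr rfl fun i _ => ?_
    rw [map_zsmul, map_zsmul]
    simp
  rw [this]

/-- For incommensurate lattices `R_1, …, R_{p+1}` (with `R_1 = E·ℤ^d` indexed by `0`) and dual
vectors `k_2, …, k_{p+1}` not all zero, the lattice Weyl sums of
`e^{−2πi (k_2 + ⋯ + k_{p+1})·n}` over `R_1 ∩ B_r` tend to zero. -/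
theorem stmt11 {d p : ℕ} (E : Fin (p + 1) → Matrix (Fin d) (Fin d) ℝ)
    (hE : ∀ j, IsUnit (E j).det) (hinc : Incommensurate E)
    (k : Fin (p + 1) → EuclideanSpace ℝ (Fin d)) (hk : ∀ j, k j ∈ dualLattice (E j))
    (hk0 : k 0 = 0) (hne : ∃ j, k j ≠ 0) :
    Tendsto
      (fun r : ℝ =>
        ((Nat.card ↥(latticeSet (E 0) ∩ Metric.closedBall 0 r) : ℂ))⁻¹ *
          ∑' n : ↥(latticeSet (E 0) ∩ Metric.closedBall 0 r),
            Complex.exp (-(2 * Real.pi * Complex.I) *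
              ((⟪∑ j, k j, (n : EuclideanSpace ℝ (Fin d))⟫ : ℝ) : ℂ)))
      atTop (nhds 0) := by
  have hd : NeZero d := ⟨by
    rintro rfl
    obtain ⟨j, hj⟩ := hne
    exact hj (Subsingleton.elim _ _)⟩
  set K := ∑ j, k j with hK
  -- the total frequency is not in the dual lattice of the first lattice
  have hKn : K ∉ dualLattice (E 0) := by
    intro hmem
    have hmem' : -K ∈ dualLattice (E 0) := by
      intro n hn
      obtain ⟨z, hz⟩ := hmem n hn
      exact ⟨-z, by rw [inner_neg_left, hz]; push_cast; rfl⟩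
    have h0 := (hinc (Function.update k 0 (-K)) (by
      intro j
      by_cases hj : j = 0
      · subst hj; simpa using hmem'
      · simpa [Function.update_of_ne hj] using hk j)).1 (by
        rw [Fin.sum_univ_succ]
        rw [hK, Fin.sum_univ_succ, hk0]
        simp)
    obtain ⟨j, hj⟩ := hne
    have hj0 : j ≠ 0 := by rintro rfl; exact hj hk0
    have := h0 j
    rw [Function.update_of_ne hj0] at this
    exact hj this
  obtain ⟨b, hb⟩ := aux_lattice (E 0) (hE 0)
  have hKn2 : ∃ n0 ∈ latticeSet (E 0), ¬ ∃ z : ℤ, ⟪K, n0⟫ = (z : ℝ) := by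
    by_contra hcon
    push Not at hcon
    exact hKn hcon
  obtain ⟨n0, hn0, hn0z⟩ := hKn2
  set f : EuclideanSpace ℝ (Fin d) → ℂ := fun n =>
    Complex.exp (-(2 * Real.pi * Complex.I) * ((⟪K, n⟫ : ℝ) : ℂ)) with hf
  have hf1 : ∀ n, ‖f n‖ ≤ 1 := by
    intro n
    have : -(2 * Real.pi * Complex.I) * ((⟪K, n⟫ : ℝ) : ℂ) =
      ((-(2 * Real.pi * ⟪K, n⟫) : ℝ) : ℂ) * Complex.I := by push_cast; ring
    simp only [hf]
    rw [this, Complex.norm_exp_ofReal_mul_I]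
  have hfz : ∀ n, f (n + n0) = f n0 * f n := by
    intro n
    simp only [hf]
    rw [← Complex.exp_add, inner_add_right]
    congr 1
    push_cast
    ring
  have hz1 : f n0 ≠ 1 := by
    intro h1
    simp only [hf] at h1
    rw [Complex.exp_eq_one_iff] at h1
    obtain ⟨m, hm⟩ := h1
    apply hn0z
    refine ⟨-m, ?_⟩
    have h2 : (2 * Real.pi * Complex.I) * ((⟪K, n0⟫ : ℝ) : ℂ) =
      (2 * Real.pi * Complex.I) * (-m : ℂ) := by linear_combination -hm
    have h3 := mul_left_cancel₀ Complex.two_pi_I_ne_zero h2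
    exact_mod_cast h3
  rw [hb] at hn0
  have hfin : ∀ r : ℝ, (latticeSet (E 0) ∩ Metric.closedBall 0 r).Finite := by
    intro r
    rw [hb, Set.inter_comm]
    exact ZSpan.setFinite_inter b Metric.isBounded_closedBall
  obtain ⟨C, hC, hlim⟩ := aux_count (Submodule.span ℤ (Set.range b))
  rw [← hb] at hlim
  have hrat := aux_ratio _ C hC hlim ‖n0‖
  have hzpos : 0 < ‖1 - f n0‖ := norm_pos_iff.2 (sub_ne_zero.2 hz1.symm)
  have hbound := hrat.const_mul (2 / ‖1 - f n0‖)
  rw [mul_zero] at hbound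
  refine squeeze_zero_norm (fun r => ?_) hbound
  have hc : ∀ r : ℝ, Nat.card ↥(latticeSet (E 0) ∩ Metric.closedBall 0 r) =
      (hfin r).toFinset.card := fun r => Nat.card_eq_card_finite_toFinset (hfin r)
  have hsum : ∑' n : ↥(latticeSet (E 0) ∩ Metric.closedBall 0 r), f n =
      ∑ n ∈ (hfin r).toFinset, f n := by
    rw [← Finset.tsum_subtype]
    have : latticeSet (E 0) ∩ Metric.closedBall 0 r = {x | x ∈ (hfin r).toFinset} := by
      ext x; simp
    exact tsum_congr_set_coe f this
  have hs := aux_sum (hfin r).toFinset (hfin (r + ‖n0‖)).toFinset n0 f (f n0) hf1 hfz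
    (by
      intro x
      simp only [Set.Finite.mem_toFinset]
      rintro ⟨h1, h2⟩
      exact ⟨h1, Metric.closedBall_subset_closedBall (by linarith [norm_nonneg n0]) h2⟩)
    (by
      intro x
      simp only [Set.Finite.mem_toFinset]
      rintro ⟨h1, h2⟩
      rw [hb] at h1 ⊢
      refine ⟨Submodule.add_mem _ h1 hn0, ?_⟩
      rw [mem_closedBall_zero_iff] at h2 ⊢
      exact (norm_add_le _ _).trans (by linarith))
  change ‖_ * ∑' n : ↥(latticeSet (E 0) ∩ Metric.closedBall 0 r), f n‖ ≤ _
  rw [hsum, hc r, hc (r + ‖n0‖)]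
  rw [norm_mul] at hs ⊢
  rw [norm_inv, Complex.norm_natCast]
  have h5 : ‖∑ n ∈ (hfin r).toFinset, f n‖ ≤ 2 / ‖1 - f n0‖ *
      (((hfin (r + ‖n0‖)).toFinset.card : ℝ) - (hfin r).toFinset.card) := by
    rw [div_mul_eq_mul_div, le_div_iff₀ hzpos]
    linarith
  calc _ ≤ (((hfin r).toFinset.card : ℝ))⁻¹ * (2 / ‖1 - f n0‖ *
      (((hfin (r + ‖n0‖)).toFinset.card : ℝ) - (hfin r).toFinset.card)) := by gcongr
    _ = _ := by rw [div_eq_mul_inv (_ - _)]; ring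
end
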